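/- (Increment bound from the proof of Theorem 3.2.) Under hypotheses (i)–(iv) of the inexact anchored iteration, for all 1 ≤ k ≤ n one has sp(Q^k − Q^{k−1}) ≤ (4/(k+1))·sp(Q^0 − Q^*) + 2·ε. -/

import Mathlib

open Finset

/-- Span seminorm: `sp x = max x − min x` on a nonempty finite index set. -/
noncomputable def sp {J : Type*} [Fintype J] [Nonempty J] (x : J → ℝ) : ℝ :=
  (univ.sup' univ_nonempty x) - (univ.inf' univ_nonempty x)

/-- Sup norm `‖x‖_∞ = max_j |x j|` on a nonempty finite index set. -/
noncomputable def supNorm {J : Type*} [Fintype J] [Nonempty J] (x : J → ℝ) : ℝ :=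
  univ.sup' univ_nonempty (fun j => |x j|)

/-- `P` is a transition kernel: nonnegative entries, each row sums to one. -/
def IsKernel {S A : Type*} [Fintype S] (P : S → A → S → ℝ) : Prop :=
  (∀ s a s', 0 ≤ P s a s') ∧ (∀ s a, ∑ s', P s a s' = 1)

/-- The Bellman operator `𝒯(Q)(s,a) = r(s,a) + ∑_{s'} P(s'|s,a)·max_{a'} Q(s',a')`. -/
noncomputable def bellman {S A : Type*} [Fintype S] [Fintype A] [Nonempty A]
    (P : S → A → S → ℝ) (r : S → A → ℝ) (Q : S × A → ℝ) : S × A → ℝ :=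
  fun p => r p.1 p.2 + ∑ s', P p.1 p.2 s' * (univ.sup' univ_nonempty (fun a' => Q (s', a')))

/-- The anchoring coefficients `β_k = k/(k+2)`. -/
noncomputable def beta (k : ℕ) : ℝ := (k : ℝ) / ((k : ℝ) + 2)

theorem sub_le_sp {J : Type*} [Fintype J] [Nonempty J] (x : J → ℝ) (i j : J) :
    x i - x j ≤ sp x :=
  sub_le_sub (le_sup' x (mem_univ i)) (inf'_le x (mem_univ j))

theorem sp_le {J : Type*} [Fintype J] [Nonempty J] {x : J → ℝ} {c : ℝ}
    (h : ∀ i j, x i - x j ≤ c) : sp x ≤ c := by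
  obtain ⟨i, -, hi⟩ := exists_mem_eq_sup' univ_nonempty x
  obtain ⟨j, -, hj⟩ := exists_mem_eq_inf' univ_nonempty x
  rw [sp, hi, hj]
  exact h i j

theorem sp_nonneg {J : Type*} [Fintype J] [Nonempty J] (x : J → ℝ) : 0 ≤ sp x := by
  obtain ⟨j⟩ := ‹Nonempty J›
  simpa using sub_le_sp x j j

/-- The span seminorm of a nonnegative combination of two vectors. -/
theorem sp_combination_le {J : Type*} [Fintype J] [Nonempty J] {x y : J → ℝ} {a b : ℝ}
    (ha : 0 ≤ a) (hb : 0 ≤ b) :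
    sp (fun j => a * x j + b * y j) ≤ a * sp x + b * sp y := by
  refine sp_le fun i j => ?_
  have hx := mul_le_mul_of_nonneg_left (sub_le_sp x i j) ha
  have hy := mul_le_mul_of_nonneg_left (sub_le_sp y i j) hb
  linarith

theorem abs_le_supNorm {J : Type*} [Fintype J] [Nonempty J] (x : J → ℝ) (j : J) :
    |x j| ≤ supNorm x :=
  le_sup' (fun j => |x j|) (mem_univ j)

theorem bellman_le_add {S A : Type*} [Fintype S] [Fintype A] [Nonempty A]
    {P : S → A → S → ℝ} (hP : IsKernel P) (r : S → A → ℝ) {Q Q' : S × A → ℝ} {c : ℝ}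
    (h : ∀ p, Q p ≤ Q' p + c) (p : S × A) : bellman P r Q p ≤ bellman P r Q' p + c := by
  have hmax : ∀ s, univ.sup' univ_nonempty (fun a => Q (s, a)) ≤
      univ.sup' univ_nonempty (fun a => Q' (s, a)) + c := fun s =>
    sup'_le _ _ fun a _ => (h (s, a)).trans
      (add_le_add_left (le_sup' (fun a => Q' (s, a)) (mem_univ a)) c)
  have hsum := sum_le_sum fun s (_ : s ∈ univ) =>
    mul_le_mul_of_nonneg_left (hmax s) (hP.1 p.1 p.2 s)
  simp only [mul_add, sum_add_distrib, ← sum_mul, hP.2, one_mul] at hsum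
  simp only [bellman]
  linarith

/-- The Bellman operator is nonexpansive for the span seminorm. -/
theorem sp_bellman_sub_le {S A : Type*} [Fintype S] [Nonempty S] [Fintype A] [Nonempty A]
    {P : S → A → S → ℝ} (hP : IsKernel P) (r : S → A → ℝ) (Q Q' : S × A → ℝ) :
    sp (fun p => bellman P r Q p - bellman P r Q' p) ≤ sp (fun p => Q p - Q' p) := by
  refine sp_le fun p q => ?_
  have hup := bellman_le_add hP r (Q := Q) (Q' := Q')
    (c := univ.sup' univ_nonempty fun p => Q p - Q' p)
    (fun p => by linarith [le_sup' (fun p => Q p - Q' p) (mem_univ p)]) p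
  have hlow := bellman_le_add hP r (Q := Q') (Q' := Q)
    (c := -univ.inf' univ_nonempty fun p => Q p - Q' p)
    (fun p => by linarith [inf'_le (fun p => Q p - Q' p) (mem_univ p)]) q
  simp only [sp]
  linarith

/-- One inexact Bellman step increases the span distance to a solution of the
optimality equation by at most `2 * ε`. -/
theorem sp_sub_solution_le_of_supNorm_le {S A : Type*} [Fintype S] [Nonempty S] [Fintype A]
    [Nonempty A] {P : S → A → S → ℝ} (hP : IsKernel P) {r : S → A → ℝ} {ε : ℝ}
    {Q T Qstar : S × A → ℝ} {gstar : ℝ}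
    (hT : supNorm (fun p => T p - bellman P r Q p) ≤ ε)
    (hstar : bellman P r Qstar = fun p => Qstar p + gstar) :
    sp (fun p => T p - Qstar p) ≤ sp (fun p => Q p - Qstar p) + 2 * ε := by
  refine sp_le fun p q => ?_
  have hB := (sub_le_sp (fun p => bellman P r Q p - bellman P r Qstar p) p q).trans
    (sp_bellman_sub_le hP r Q Qstar)
  simp only [hstar] at hB
  have hp := abs_le.1 ((abs_le_supNorm (fun p => T p - bellman P r Q p) p).trans hT)
  have hq := abs_le.1 ((abs_le_supNorm (fun p => T p - bellman P r Q p) q).trans hT)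
  linarith [hp.2, hq.1]

theorem beta_nonneg (k : ℕ) : 0 ≤ beta k := by
  unfold beta
  positivity

theorem one_sub_beta (k : ℕ) : 1 - beta k = 2 / ((k : ℝ) + 2) := by
  unfold beta
  field_simp
  ring

theorem beta_succ_sub_beta (k : ℕ) :
    beta (k + 1) - beta k = 2 / (((k : ℝ) + 2) * ((k : ℝ) + 3)) := by
  unfold beta
  push_cast
  field_simp
  ring

/-- Anchoring keeps the span distance to a solution within a linearly growing error. -/
theorem sp_anchored_sub_solution_le {S A : Type*} [Fintype S] [Nonempty S] [Fintype A]
    [Nonempty A] {P : S → A → S → ℝ} (hP : IsKernel P) {r : S → A → ℝ} {ε : ℝ} {n : ℕ}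
    {Q T : ℕ → S × A → ℝ} {Qstar : S × A → ℝ} {gstar : ℝ}
    (hQ : ∀ k, 1 ≤ k → k ≤ n →
      Q k = fun p => (1 - beta k) * Q 0 p + beta k * T (k - 1) p)
    (hT : ∀ k, k ≤ n → supNorm (fun p => T k p - bellman P r (Q k) p) ≤ ε)
    (hstar : bellman P r Qstar = fun p => Qstar p + gstar) (k : ℕ) (hk : k ≤ n) :
    sp (fun p => Q k p - Qstar p) ≤ sp (fun p => Q 0 p - Qstar p) + 2 * ε * (k / 3) := by
  induction k with
  | zero => simp
  | succ k ih =>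
    have hstep := sp_sub_solution_le_of_supNorm_le hP (hT k (by omega)) hstar
    have hcomb : (fun p => Q (k + 1) p - Qstar p) = fun p =>
        (1 - beta (k + 1)) * (Q 0 p - Qstar p) + beta (k + 1) * (T k p - Qstar p) := by
      funext p
      rw [hQ (k + 1) (by omega) hk, Nat.add_sub_cancel]
      ring
    have hanchor : 0 ≤ 1 - beta (k + 1) := by
      rw [one_sub_beta]
      positivity
    have hle := mul_le_mul_of_nonneg_left
      (hstep.trans (add_le_add_left (ih (by omega)) _)) (beta_nonneg (k + 1))
    have hbeta : beta (k + 1) * ((k : ℝ) / 3 + 1) = ((k : ℝ) + 1) / 3 := by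
      unfold beta
      push_cast
      field_simp
      ring
    rw [hcomb]
    refine (sp_combination_le hanchor (beta_nonneg (k + 1))).trans ?_
    push_cast
    linear_combination hle + 2 * ε * hbeta

/-- The sharper form of the increment bound that is propagated by induction. -/
theorem sp_anchored_increment_le {S A : Type*} [Fintype S] [Nonempty S] [Fintype A]
    [Nonempty A] {P : S → A → S → ℝ} (hP : IsKernel P) {r : S → A → ℝ} {ε : ℝ} {n : ℕ}
    {Q T : ℕ → S × A → ℝ} {Qstar : S × A → ℝ} {gstar : ℝ}
    (hQ : ∀ k, 1 ≤ k → k ≤ n →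
      Q k = fun p => (1 - beta k) * Q 0 p + beta k * T (k - 1) p)
    (hT : ∀ k, k ≤ n → supNorm (fun p => T k p - bellman P r (Q k) p) ≤ ε)
    (hstar : bellman P r Qstar = fun p => Qstar p + gstar)
    (hinc : ∀ k, 1 ≤ k → k ≤ n →
      sp (fun p => T k p - T (k - 1) p) ≤ sp (fun p => Q k p - Q (k - 1) p))
    (k : ℕ) (hk : k + 1 ≤ n) :
    ((k : ℝ) + 2) * (k + 3) * sp (fun p => Q (k + 1) p - Q k p) ≤
      4 * (k + 1) * sp (fun p => Q 0 p - Qstar p) +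
        2 * ε * ((k + 2) * (k + 3) / 3) := by
  have hanchor : ∀ j ≤ n, sp (fun p => T j p - Q 0 p) ≤
      2 * sp (fun p => Q 0 p - Qstar p) + 2 * ε * (j / 3 + 1) := fun j hj => by
    have hstep := sp_sub_solution_le_of_supNorm_le hP (hT j hj) hstar
    have hdist := sp_anchored_sub_solution_le hP hQ hT hstar j hj
    refine sp_le fun p q => ?_
    have hTpq := sub_le_sp (fun p => T j p - Qstar p) p q
    have hQqp := sub_le_sp (fun p => Q 0 p - Qstar p) q p
    linarith
  induction k with
  | zero =>
    have hQ1 : (fun p => Q (0 + 1) p - Q 0 p) = fun p =>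
        beta 1 * (T 0 p - Q 0 p) + 0 * (0 : ℝ) := by
      funext p
      rw [hQ (0 + 1) le_rfl hk]
      ring_nf
    have hcomb := sp_combination_le (x := fun p => T 0 p - Q 0 p) (y := fun _ => (0 : ℝ))
      (beta_nonneg 1) le_rfl
    have h0 := hanchor 0 (by omega)
    have hbeta : beta 1 = 1 / 3 := by norm_num [beta]
    rw [hQ1]
    rw [hbeta] at hcomb ⊢
    push_cast at h0 ⊢
    linarith
  | succ k ih =>
    have hdiff : (fun p => Q (k + 1 + 1) p - Q (k + 1) p) = fun p =>
        2 / (((k : ℝ) + 3) * (k + 4)) * (T k p - Q 0 p) +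
          beta (k + 2) * (T (k + 1) p - T k p) := by
      have hbeta := beta_succ_sub_beta (k + 1)
      funext p
      rw [hQ (k + 1 + 1) (by omega) hk, hQ (k + 1) (by omega) (by omega)]
      simp only [Nat.add_sub_cancel]
      have hcoef : 2 / (((k : ℝ) + 3) * (k + 4)) = beta (k + 2) - beta (k + 1) := by
        rw [hbeta]
        push_cast
        ring_nf
      rw [hcoef]
      ring
    have hcomb := sp_combination_le (x := fun p => T k p - Q 0 p)
      (y := fun p => T (k + 1) p - T k p) (a := 2 / (((k : ℝ) + 3) * (k + 4)))
      (by positivity) (beta_nonneg (k + 2))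
    rw [← hdiff] at hcomb
    have hscaled := mul_le_mul_of_nonneg_left hcomb
      (by positivity : 0 ≤ ((k : ℝ) + 3) * (k + 4))
    have hexpand : ∀ x y : ℝ, ((k : ℝ) + 3) * (k + 4) *
        (2 / (((k : ℝ) + 3) * (k + 4)) * x + beta (k + 2) * y) =
        2 * x + (k + 2) * (k + 3) * y := fun x y => by
      unfold beta
      push_cast
      field_simp
      ring
    rw [hexpand] at hscaled
    have hT1 := mul_le_mul_of_nonneg_left (hinc (k + 1) (by omega) (by omega))
      (by positivity : 0 ≤ ((k : ℝ) + 2) * (k + 3))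
    simp only [Nat.add_sub_cancel] at hT1
    push_cast
    linear_combination hscaled + hT1 + ih (by omega) + 2 * hanchor k (by omega)

/-- Increment bound from the proof of Theorem 3.2: under the inexact anchored iteration
hypotheses (i)–(iv), `sp(Q^k − Q^{k−1}) ≤ (4/(k+1))·sp(Q^0 − Q^*) + 2·ε` for `1 ≤ k ≤ n`. -/
theorem savia_increment_bound

    {S A : Type*} [Fintype S] [Nonempty S] [Fintype A] [Nonempty A]
    (P : S → A → S → ℝ) (hP : IsKernel P) (r : S → A → ℝ)
    (ε : ℝ) (hε : 0 ≤ ε) (n : ℕ)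
    (Q T : ℕ → S × A → ℝ) (Qstar : S × A → ℝ) (gstar : ℝ)
    (h1 : ∀ k, 1 ≤ k → k ≤ n →
      Q k = fun p => (1 - beta k) * Q 0 p + beta k * T (k - 1) p)
    (h2 : ∀ k, k ≤ n → supNorm (fun p => T k p - bellman P r (Q k) p) ≤ ε)
    (h3 : bellman P r Qstar = fun p => Qstar p + gstar)
    (h4 : ∀ k, 1 ≤ k → k ≤ n →
      sp (fun p => T k p - T (k - 1) p) ≤ sp (fun p => Q k p - Q (k - 1) p))
    :
    ∀ k, 1 ≤ k → k ≤ n → sp (fun p => Q k p - Q (k - 1) p)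
      ≤ (4 / ((k : ℝ) + 1)) * sp (fun p => Q 0 p - Qstar p) + 2 * ε := by
  intro k hk hkn
  obtain ⟨k, rfl⟩ := Nat.exists_eq_add_of_le' hk
  have hbound := sp_anchored_increment_le hP h1 h2 h3 h4 k hkn
  rw [Nat.add_sub_cancel]
  have hpos : 0 < ((k : ℝ) + 2) * (k + 3) := by positivity
  refine le_of_mul_le_mul_left (hbound.trans ?_) hpos
  have hexpand : ((k : ℝ) + 2) * (k + 3) *
      (4 / (((k + 1 : ℕ) : ℝ) + 1) * sp (fun p => Q 0 p - Qstar p) + 2 * ε) =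
      4 * (k + 3) * sp (fun p => Q 0 p - Qstar p) + 2 * ε * ((k + 2) * (k + 3)) := by
    push_cast
    field_simp
    ring
  rw [hexpand]
  have hk0 : (0 : ℝ) ≤ k := k.cast_nonneg
  refine add_le_add (mul_le_mul_of_nonneg_right (by linarith) (sp_nonneg _))
    (mul_le_mul_of_nonneg_left (by nlinarith) (by linarith))
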